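/- Let φ:(R,m,K)→(S,n,L) be a flat local homomorphism of Noetherian local rings of prime characteristic p with S/mS Gorenstein. Let z_1,…,z_d ∈ S be elements whose images form a system of parameters in S/mS, and write (z)^[t] = (z_1^t,…,z_d^t)S. Let I ⊆ R be an ideal with ℓ(R/I) < ∞ and dim_K((I :_R m)/I) = 1. Assume that some c ∈ S − mS is a test element for S and that S/mS is F-rational. Then the following are equivalent: (i) I is tightly closed in R; (ii) IS + (z)^[t] is tightly closed in S for every t > 0; (iii) IS + (z)^[t] is tightly closed in S for some t > 0. -/

import Mathlib

open IsLocalRing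

/-- The Frobenius power `I^[q]` of an ideal: the ideal generated by the `q`-th powers
of the elements of `I`. -/
def Ideal.frobPow {R : Type*} [CommRing R] (I : Ideal R) (q : ℕ) : Ideal R :=
  Ideal.span ((fun x : R => x ^ q) '' (I : Set R))

/-- `R°`: the complement in `R` of the union of the minimal primes of `R`. -/
def circComplement (R : Type*) [CommRing R] : Set R :=
  {c : R | ∀ P ∈ minimalPrimes R, c ∉ P}

/-- `x ∈ I*`: tight closure membership (`p` is the characteristic). -/
def MemTightClosure {R : Type*} [CommRing R] (p : ℕ) (I : Ideal R) (x : R) : Prop :=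
  ∃ c ∈ circComplement R, ∃ N : ℕ, ∀ e : ℕ, N ≤ e → c * x ^ p ^ e ∈ I.frobPow (p ^ e)

/-- An ideal is tightly closed if `I* = I`. -/
def Ideal.IsTightlyClosed {R : Type*} [CommRing R] (p : ℕ) (I : Ideal R) : Prop :=
  ∀ x : R, MemTightClosure p I x → x ∈ I

/-- An ideal is Frobenius closed if `x^q ∈ I^[q]` for some `q` implies `x ∈ I`. -/
def Ideal.IsFrobeniusClosed {R : Type*} [CommRing R] (p : ℕ) (I : Ideal R) : Prop :=
  ∀ x : R, (∃ e : ℕ, x ^ p ^ e ∈ I.frobPow (p ^ e)) → x ∈ I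

/-- A ring is weakly F-regular if every ideal is tightly closed. -/
def IsWeaklyFRegular (R : Type*) [CommRing R] (p : ℕ) : Prop :=
  ∀ I : Ideal R, I.IsTightlyClosed p

/-- A test element: an element of `R°` that works in every tight closure test. -/
def IsTestElement {R : Type*} [CommRing R] (p : ℕ) (c : R) : Prop :=
  c ∈ circComplement R ∧
    ∀ (I : Ideal R) (x : R), MemTightClosure p I x → ∀ e : ℕ, c * x ^ p ^ e ∈ I.frobPow (p ^ e)

/-- A (full) system of parameters of a local ring: `dim R` elements of the maximal
ideal generating an ideal whose radical is the maximal ideal. -/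
def IsSystemOfParameters (R : Type*) [CommRing R] [IsLocalRing R] {n : ℕ} (x : Fin n → R) : Prop :=
  ringKrullDim R = n ∧ (∀ i, x i ∈ maximalIdeal R) ∧
    maximalIdeal R ≤ (Ideal.span (Set.range x)).radical

/-- A parameter ideal: an ideal generated by part of a system of parameters. -/
def Ideal.IsParameterIdeal {R : Type*} [CommRing R] [IsLocalRing R] (I : Ideal R) : Prop :=
  ∃ (n k : ℕ) (h : k ≤ n) (x : Fin n → R), IsSystemOfParameters R x ∧
    I = Ideal.span (Set.range fun i : Fin k => x (Fin.castLE h i))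

/-- A local ring is F-rational if every parameter ideal is tightly closed. -/
def IsFRational (R : Type*) [CommRing R] [IsLocalRing R] (p : ℕ) : Prop :=
  ∀ I : Ideal R, I.IsParameterIdeal → I.IsTightlyClosed p

/-- A local ring is F-injective if every parameter ideal is Frobenius closed. -/
def IsFInjective (R : Type*) [CommRing R] [IsLocalRing R] (p : ℕ) : Prop :=
  ∀ I : Ideal R, I.IsParameterIdeal → I.IsFrobeniusClosed p

/-- A local ring is Cohen-Macaulay if some system of parameters is a regular sequence. -/
def IsCohenMacaulayLocalRing (R : Type*) [CommRing R] [IsLocalRing R] : Prop :=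
  ∃ (n : ℕ) (x : Fin n → R), IsSystemOfParameters R x ∧
    RingTheory.Sequence.IsRegular R (List.ofFn x)

/-- An irreducible ideal: a proper ideal that is not the intersection of two
strictly larger ideals. -/
def Ideal.IsIrreducible {R : Type*} [CommRing R] (I : Ideal R) : Prop :=
  I ≠ ⊤ ∧ ∀ A B : Ideal R, I = A ⊓ B → I = A ∨ I = B

/-- A local ring is Gorenstein if it is Cohen-Macaulay and some system of parameters
generates an irreducible ideal. -/
def IsGorensteinLocalRing (R : Type*) [CommRing R] [IsLocalRing R] : Prop :=
  ∃ (n : ℕ) (x : Fin n → R), IsSystemOfParameters R x ∧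
    RingTheory.Sequence.IsRegular R (List.ofFn x) ∧
    (Ideal.span (Set.range x)).IsIrreducible

/-- The socle `(I :_R m)/I` of `R ⧸ I` is one-dimensional over the residue field,
with (the image of) `u` as a generator. -/
def GeneratesSocle {R : Type*} [CommRing R] [IsLocalRing R] (I : Ideal R) (u : R) : Prop :=
  u ∈ Submodule.colon I (maximalIdeal R) ∧ u ∉ I ∧
    ∀ v ∈ Submodule.colon I (maximalIdeal R), ∃ r : R, v - r * u ∈ I

/-- `dim_K ((I :_R m)/I) = 1`: the socle of `R ⧸ I` is one-dimensional over the
residue field. -/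
def SocleDimOne {R : Type*} [CommRing R] [IsLocalRing R] (I : Ideal R) : Prop :=
  ∃ u : R, GeneratesSocle I u

/-- `x` is a nonzerodivisor modulo the ideal `J`. -/
def Ideal.IsNonzerodivisorModulo {A : Type*} [CommRing A] (J : Ideal A) (x : A) : Prop :=
  ∀ a : A, x * a ∈ J → a ∈ J

/-- A list is a (weakly) regular sequence modulo the ideal `J`. -/
def Ideal.IsRegularSequenceModulo {A : Type*} [CommRing A] : Ideal A → List A → Prop
  | _, [] => True
  | J, x :: l => J.IsNonzerodivisorModulo x ∧ (J ⊔ Ideal.span {x}).IsRegularSequenceModulo l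

section RegularSequences

variable {A : Type*} [CommRing A]

theorem Ideal.isRegularSequenceModulo_append (J : Ideal A) (l₁ l₂ : List A) :
    J.IsRegularSequenceModulo (l₁ ++ l₂) ↔
      J.IsRegularSequenceModulo l₁ ∧ (J ⊔ Ideal.ofList l₁).IsRegularSequenceModulo l₂ := by
  induction l₁ generalizing J with
  | nil => simp [Ideal.IsRegularSequenceModulo]
  | cons x l ih => simp [Ideal.IsRegularSequenceModulo, ih, sup_assoc, and_assoc]

theorem Ideal.IsNonzerodivisorModulo.swap [IsNoetherianRing A] [IsLocalRing A]
    {J : Ideal A} {x w : A} (hx : x ∈ maximalIdeal A)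
    (h : J.IsNonzerodivisorModulo x) (hw : (J ⊔ Ideal.span {x}).IsNonzerodivisorModulo w) :
    J.IsNonzerodivisorModulo w ∧ (J ⊔ Ideal.span {w}).IsNonzerodivisorModulo x := by
  constructor
  · let K : Ideal A := Submodule.comap (LinearMap.mulLeft A w) J
    have hK : ∀ a, a ∈ K ↔ w * a ∈ J := fun a => Iff.rfl
    have hle : K ≤ J := by
      refine Submodule.le_of_le_smul_of_le_jacobson_bot (I := Ideal.span {x})
        (IsNoetherian.noetherian K) ?_ ?_
      · rw [IsLocalRing.jacobson_eq_maximalIdeal ⊥ bot_ne_top]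
        simpa [Ideal.span_le] using hx
      · intro a ha
        rw [hK] at ha
        obtain ⟨j, hj, y, hy, rfl⟩ := Submodule.mem_sup.mp (hw a (Ideal.mem_sup_left ha))
        obtain ⟨b, rfl⟩ := Ideal.mem_span_singleton'.mp hy
        refine Submodule.add_mem_sup hj ?_
        rw [mul_comm]
        refine Ideal.mul_mem_mul (Ideal.mem_span_singleton_self x) ((hK b).mpr (h _ ?_))
        convert! J.sub_mem ha (J.mul_mem_left w hj) using 1
        ring
    exact fun a ha => hle ha
  · intro a ha
    obtain ⟨j, hj, y, hy, e⟩ := Submodule.mem_sup.mp ha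
    obtain ⟨b, rfl⟩ := Ideal.mem_span_singleton'.mp hy
    have hb : b ∈ J ⊔ Ideal.span {x} := by
      apply hw
      have : w * b = -j + a * x := by linear_combination e
      rw [this]
      exact Submodule.add_mem_sup (J.neg_mem hj)
        (Ideal.mem_span_singleton'.mpr ⟨a, rfl⟩)
    obtain ⟨j', hj', y', hy', e'⟩ := Submodule.mem_sup.mp hb
    obtain ⟨b', rfl⟩ := Ideal.mem_span_singleton'.mp hy'
    have hJ : a - w * b' ∈ J := by
      apply h
      have : x * (a - w * b') = j + w * j' := by linear_combination -e - w * e'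
      rw [this]
      exact J.add_mem hj (J.mul_mem_left _ hj')
    have : a = (a - w * b') + b' * w := by ring
    rw [this]
    exact Submodule.add_mem_sup hJ (Ideal.mem_span_singleton'.mpr ⟨b', rfl⟩)

theorem Ideal.isRegularSequenceModulo_append_singleton_iff [IsNoetherianRing A] [IsLocalRing A]
    {J : Ideal A} {w : A} (hw : w ∈ maximalIdeal A) {l : List A}
    (hl : ∀ x ∈ l, x ∈ maximalIdeal A) :
    J.IsRegularSequenceModulo (l ++ [w]) ↔ J.IsRegularSequenceModulo (w :: l) := by
  induction l generalizing J with
  | nil => rfl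
  | cons x l ih =>
    have hx : x ∈ maximalIdeal A := hl x (by simp)
    have ih' := ih (J := J ⊔ Ideal.span {x}) fun y hy => hl y (by simp [hy])
    simp only [List.cons_append, Ideal.IsRegularSequenceModulo] at ih' ⊢
    rw [ih', sup_right_comm]
    constructor
    · rintro ⟨h1, h2, h3⟩
      exact ⟨(h1.swap hx h2).1, (h1.swap hx h2).2, h3⟩
    · rintro ⟨h1, h2, h3⟩
      exact ⟨(h1.swap hw h2).1, (h1.swap hw h2).2, h3⟩

theorem Ideal.IsNonzerodivisorModulo.of_le_radical {Y : Ideal A} {w y : A}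
    (hw : Y.IsNonzerodivisorModulo w) (h : w ∈ (Y ⊔ Ideal.span {y}).radical) :
    Y.IsNonzerodivisorModulo y := by
  intro a ha
  obtain ⟨k, hk⟩ := h
  have hpow : ∀ k : ℕ, ∀ b, w ^ k * b ∈ Y → b ∈ Y := by
    intro k
    induction k with
    | zero => simp
    | succ k ih => exact fun b hb => ih b (hw _ (by rwa [← mul_assoc, ← pow_succ']))
  refine hpow k a ?_
  obtain ⟨j, hj, t, ht, e⟩ := Submodule.mem_sup.mp hk
  obtain ⟨r, rfl⟩ := Ideal.mem_span_singleton'.mp ht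
  have : w ^ k * a = a * j + r * (y * a) := by rw [← e]; ring
  rw [this]
  exact Y.add_mem (Y.mul_mem_left _ hj) (Y.mul_mem_left _ ha)

theorem Ideal.exists_mem_forall_notMem_of_finite {ι : Type*} {s : Set ι} (hs : s.Finite)
    (f : ι → Ideal A) (hf : ∀ i ∈ s, (f i).IsPrime) (m : Ideal A) (hm : ∀ i ∈ s, ¬ m ≤ f i) :
    ∃ w ∈ m, ∀ i ∈ s, w ∉ f i := by
  by_contra! hcon
  rcases s.eq_empty_or_nonempty with rfl | ⟨i₀, _⟩
  · simpa using hcon 0 m.zero_mem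
  · have hsub : (m : Set A) ⊆ ⋃ i ∈ (↑hs.toFinset : Set ι), f i := by
      intro w hw
      obtain ⟨i, hi, hwi⟩ := hcon w hw
      simp only [Set.mem_iUnion]
      exact ⟨i, by simpa using hi, hwi⟩
    obtain ⟨i, hi, hle⟩ := (Ideal.subset_union_prime i₀ i₀
      (fun i hi _ _ => hf i (by simpa using hi))).mp hsub
    exact hm i (by simpa using hi) hle

theorem Ideal.le_radical_sup_span_of_notMem_minimalPrimes [IsNoetherianRing A] [IsLocalRing A]
    {Y : Ideal A} {y w : A} (hym : y ∈ maximalIdeal A)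
    (hy : maximalIdeal A ≤ (Y ⊔ Ideal.span {y}).radical)
    (hw : ∀ P ∈ Y.minimalPrimes, P ≠ maximalIdeal A → w ∉ P) :
    maximalIdeal A ≤ (Y ⊔ Ideal.span {w}).radical := by
  rw [Ideal.radical_eq_sInf]
  refine le_sInf ?_
  rintro Q ⟨hQ, hQp⟩
  obtain ⟨P, hP, hPQ⟩ := Ideal.exists_minimalPrimes_le (le_sup_left.trans hQ)
  have hPp : P.IsPrime := hP.1.1
  have hQm := IsLocalRing.le_maximalIdeal hQp.ne_top
  by_cases hPm : P = maximalIdeal A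
  · rw [← hPm]; exact hPQ
  have hwQ : w ∈ Q := hQ (Ideal.mem_sup_right (Ideal.mem_span_singleton_self w))
  have hPQ' : P < Q := lt_of_le_of_ne hPQ fun h => hw P hP hPm (h ▸ hwQ)
  by_contra hne
  have hQm' : Q < maximalIdeal A := lt_of_le_not_ge hQm hne
  have hmin : maximalIdeal A ∈ (P ⊔ Ideal.span {y}).minimalPrimes := by
    refine ⟨⟨inferInstance, sup_le (hPQ.trans hQm) (by simpa [Ideal.span_le] using hym)⟩, ?_⟩
    rintro T ⟨hT, hT'⟩ -
    exact hy.trans (hT.radical_le_iff.mpr ((sup_le_sup_right hP.1.2 _).trans hT'))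
  have hht := Ideal.map_height_le_one_of_mem_minimalPrimes hmin
  have hsurj : Function.Surjective (Ideal.Quotient.mk P) := Ideal.Quotient.mk_surjective
  have hcm : ∀ T : Ideal A, P ≤ T →
      (T.map (Ideal.Quotient.mk P)).comap (Ideal.Quotient.mk P) = T := by
    intro T hT
    rw [Ideal.comap_map_of_surjective _ hsurj, ← RingHom.ker_eq_comap_bot, Ideal.mk_ker]
    exact sup_eq_left.mpr hT
  have hpr : ∀ T : Ideal A, T.IsPrime → P ≤ T → (T.map (Ideal.Quotient.mk P)).IsPrime := by
    intro T hT hPT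
    exact Ideal.map_isPrime_of_surjective hsurj (by rwa [Ideal.mk_ker])
  have := hpr Q hQp hPQ
  have := hpr _ inferInstance (hPQ.trans hQm)
  have hlt : Q.map (Ideal.Quotient.mk P) < (maximalIdeal A).map (Ideal.Quotient.mk P) := by
    refine lt_of_le_not_ge (Ideal.map_mono hQm) fun h => hne ?_
    have := Ideal.comap_mono (f := Ideal.Quotient.mk P) h
    rwa [hcm Q hPQ, hcm _ (hPQ.trans hQm)] at this
  have h1 := (Ideal.height_strict_mono_of_isPrime hlt).trans_le hht
  have h2 := Ideal.height_eq_zero_iff_eq_bot.mp (Order.lt_one_iff.mp h1)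
  rw [Ideal.map_eq_bot_iff_le_ker, Ideal.mk_ker] at h2
  exact hPQ'.not_ge h2

theorem Ideal.exists_mem_isNonzerodivisorModulo_and_le_radical
    [IsNoetherianRing A] [IsLocalRing A] {X Y : Ideal A} {x y : A}
    (hxm : x ∈ maximalIdeal A) (hx : X.IsNonzerodivisorModulo x)
    (hy : maximalIdeal A ≤ (Y ⊔ Ideal.span {y}).radical) (hym : y ∈ maximalIdeal A) :
    ∃ w ∈ maximalIdeal A, X.IsNonzerodivisorModulo w ∧
      maximalIdeal A ≤ (Y ⊔ Ideal.span {w}).radical := by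
  have hfin : (associatedPrimes A (A ⧸ X) ∪ {P ∈ Y.minimalPrimes | P ≠ maximalIdeal A}).Finite :=
    (associatedPrimes.finite A (A ⧸ X)).union
      ((Ideal.finite_minimalPrimes_of_isNoetherianRing A Y).subset fun _ h => h.1)
  have hass := biUnion_associatedPrimes_eq_zero_divisors A (A ⧸ X)
  have hnzd : ∀ w : A, X.IsNonzerodivisorModulo w ↔ ∀ P ∈ associatedPrimes A (A ⧸ X), w ∉ P := by
    intro w
    have hw : (∀ P ∈ associatedPrimes A (A ⧸ X), w ∉ P) ↔
        w ∉ ⋃ p ∈ associatedPrimes A (A ⧸ X), (p : Set A) := by simp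
    rw [hw, hass]
    constructor
    · rintro h ⟨a, ha, hwa⟩
      obtain ⟨a, rfl⟩ := Ideal.Quotient.mk_surjective a
      refine ha (Ideal.Quotient.eq_zero_iff_mem.mpr (h a ?_))
      rw [← Ideal.Quotient.eq_zero_iff_mem, ← hwa]
      rfl
    · intro h a ha
      by_contra hna
      refine h ⟨Ideal.Quotient.mk X a, fun h0 => hna (Ideal.Quotient.eq_zero_iff_mem.mp h0), ?_⟩
      rw [← Ideal.Quotient.eq_zero_iff_mem] at ha
      exact ha
  obtain ⟨w, hwm, hw⟩ := Ideal.exists_mem_forall_notMem_of_finite hfin id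
    (by
      rintro P (hP | hP)
      · exact hP.isPrime
      · exact hP.1.1.1)
    (maximalIdeal A) (by
      rintro P (hP | hP) hle
      · exact (hnzd x).mp hx P hP (hle hxm)
      · have : P.IsPrime := hP.1.1.1
        exact hP.2 (le_antisymm (IsLocalRing.le_maximalIdeal this.ne_top) hle))
  exact ⟨w, hwm, (hnzd w).mpr fun P hP => hw P (Or.inl hP),
    Ideal.le_radical_sup_span_of_notMem_minimalPrimes hym hy fun P hP hPm => hw P (Or.inr ⟨hP, hPm⟩)⟩

/-- In a Cohen-Macaulay local ring every system of parameters is a regular sequence. -/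
theorem Ideal.IsRegularSequenceModulo.of_le_radical [IsNoetherianRing A] [IsLocalRing A] :
    ∀ (n : ℕ) (J : Ideal A) (xs ys : List A), xs.length = n → ys.length = n →
      (∀ x ∈ xs, x ∈ maximalIdeal A) → (∀ y ∈ ys, y ∈ maximalIdeal A) →
      J.IsRegularSequenceModulo xs → maximalIdeal A ≤ (J ⊔ Ideal.ofList ys).radical →
      J.IsRegularSequenceModulo ys
  | 0, J, xs, ys, _, hy, _, _, _, _ => by
    rw [List.length_eq_zero_iff.mp hy]
    trivial
  | n + 1, J, xs, ys, hx, hy, hxm, hym, hreg, hrad => by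
    rcases List.eq_nil_or_concat' xs with rfl | ⟨xs, x, rfl⟩
    · simp at hx
    rcases List.eq_nil_or_concat' ys with rfl | ⟨ys, y, rfl⟩
    · simp at hy
    simp only [List.mem_append, List.mem_singleton, or_imp, forall_and, forall_eq,
      List.length_append, List.length_singleton, Nat.add_right_cancel_iff,
      Ideal.isRegularSequenceModulo_append, Ideal.ofList_append, Ideal.ofList_singleton,
      ← sup_assoc] at *
    obtain ⟨w, hwm, hwx, hwy⟩ := Ideal.exists_mem_isNonzerodivisorModulo_and_le_radical
      hxm.2 hreg.2.1 hrad hym.2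
    have h1 : J.IsRegularSequenceModulo (w :: xs) := by
      rw [← Ideal.isRegularSequenceModulo_append_singleton_iff hwm hxm.1,
        Ideal.isRegularSequenceModulo_append]
      exact ⟨hreg.1, hwx, trivial⟩
    have h2 : (J ⊔ Ideal.span {w}).IsRegularSequenceModulo ys :=
      Ideal.IsRegularSequenceModulo.of_le_radical n _ xs ys hx hy hxm.1 hym.1 h1.2
        (by rwa [sup_right_comm])
    have h3 : J.IsRegularSequenceModulo (ys ++ [w]) := by
      rw [Ideal.isRegularSequenceModulo_append_singleton_iff hwm hym.1]
      exact ⟨h1.1, h2⟩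
    rw [Ideal.isRegularSequenceModulo_append] at h3
    exact ⟨h3.1, h3.2.1.of_le_radical (hrad hwm), trivial⟩

theorem Ideal.isRegularSequenceModulo_of_forall_take {l : List A} {J : Ideal A}
    (h : ∀ i (hi : i < l.length), (J ⊔ Ideal.ofList (l.take i)).IsNonzerodivisorModulo l[i]) :
    J.IsRegularSequenceModulo l := by
  induction l generalizing J with
  | nil => trivial
  | cons x l ih =>
    refine ⟨?_, ih fun i hi => ?_⟩
    · have h0 := h 0 (by simp)
      rwa [List.take_zero, Ideal.ofList_nil, sup_bot_eq] at h0
    · have h1 := h (i + 1) (by simpa using hi)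
      rwa [List.take_succ_cons, Ideal.ofList_cons, ← sup_assoc] at h1

theorem RingTheory.Sequence.IsWeaklyRegular.isRegularSequenceModulo_bot {l : List A}
    (h : RingTheory.Sequence.IsWeaklyRegular A l) :
    (⊥ : Ideal A).IsRegularSequenceModulo l := by
  refine Ideal.isRegularSequenceModulo_of_forall_take fun i hi a ha => ?_
  have hreg := (isSMulRegular_quotient_iff_mem_of_smul_mem _ _).mp (h.regular_mod_prev i hi)
  simp only [smul_eq_mul, Ideal.mul_top] at hreg
  rw [bot_sup_eq] at ha ⊢
  exact hreg a ha

theorem Ideal.IsRegularSequenceModulo.comap {B : Type*} [CommRing B] {f : A →+* B}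
    (hf : Function.Surjective f) {J : Ideal B} {l : List A}
    (h : J.IsRegularSequenceModulo (l.map f)) : (J.comap f).IsRegularSequenceModulo l := by
  induction l generalizing J with
  | nil => trivial
  | cons x l ih =>
    refine ⟨fun a ha => h.1 _ (by simpa using ha), ?_⟩
    have : J.comap f ⊔ Ideal.span {x} = (J ⊔ Ideal.span {f x}).comap f := by
      have hJ : J ⊔ Ideal.span {f x} = (J.comap f ⊔ Ideal.span {x}).map f := by
        rw [Ideal.map_sup, Ideal.map_comap_of_surjective f hf, Ideal.map_span, Set.image_singleton]
      rw [hJ, Ideal.comap_map_of_surjective f hf, eq_comm, sup_eq_left]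
      exact (Ideal.comap_mono bot_le).trans le_sup_left
    rw [this]
    exact ih h.2

end RegularSequences

section FlatColon

variable {R S : Type*} [CommRing R] [CommRing S] [Algebra R S]

theorem Submodule.exists_smul_notMem_of_pow_smul_mem {M : Type*} [AddCommGroup M] [Module R M]
    {m : Ideal R} {N : Submodule R M} (k : ℕ) {a : M} (h : ∀ t ∈ m ^ k, t • a ∈ N) (ha : a ∉ N) :
    ∃ r : R, r • a ∉ N ∧ ∀ t ∈ m, t • r • a ∈ N := by
  induction k generalizing a with
  | zero => exact absurd (by simpa using h 1 (by simp)) ha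
  | succ k ih =>
    by_cases hm : ∀ t ∈ m, t • a ∈ N
    · exact ⟨1, by simpa using ha, by simpa using hm⟩
    · push Not at hm
      obtain ⟨t, ht, hta⟩ := hm
      obtain ⟨r, hr, hr'⟩ := ih (a := t • a)
        (fun s hs => by
          rw [smul_smul]
          exact h _ (by rw [pow_succ]; exact Ideal.mul_mem_mul hs ht)) hta
      exact ⟨r * t, by rwa [mul_smul], fun s hs => by rw [mul_smul]; exact hr' s hs⟩

/-- The ideal `Z` of the `R`-algebra `S` is such that extension from `R` to `S ⧸ Z` commutes
with colons of ideals of `R` that are primary to the maximal ideal. -/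
def Ideal.ExtensionCommutesWithColon (R : Type*) {S : Type*} [CommRing R] [CommRing S]
    [Algebra R S] [IsLocalRing R] (Z : Ideal S) : Prop :=
  ∀ J : Ideal R, maximalIdeal R ≤ J.radical → ∀ (x : R) (s : S),
    algebraMap R S x * s ∈ J.map (algebraMap R S) ⊔ Z →
      s ∈ (Submodule.colon J {x}).map (algebraMap R S) ⊔ Z

theorem Ideal.mem_map_colon_of_flat [Module.Flat R S] {J : Ideal R} {x : R} {s : S}
    (h : algebraMap R S x * s ∈ J.map (algebraMap R S)) :
    s ∈ (Submodule.colon J {x}).map (algebraMap R S) := by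
  obtain ⟨n, f, g, hfg⟩ := Submodule.mem_span_set'.mp h
  choose j hj hjg using fun i => (g i).2
  have hrel : ∑ i : Option (Fin n), (i.elim x fun i => -j i : R) • (i.elim s f : S) = 0 := by
    rw [Fintype.sum_option]
    simp only [Option.elim_none, Option.elim_some, Algebra.smul_def, map_neg, hjg, neg_mul,
      Finset.sum_neg_distrib, ← hfg]
    simp [mul_comm]
  obtain ⟨k, a, y, hy, ha⟩ := Module.Flat.isTrivialRelation_of_sum_smul_eq_zero (R := R) (M := S)
    (f := fun i : Option (Fin n) => i.elim x fun i => -j i) (x := fun i => i.elim s f) hrel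
  have hs : s = ∑ l, a none l • y l := hy none
  rw [hs]
  refine Ideal.sum_mem _ fun l _ => ?_
  rw [Algebra.smul_def]
  refine Ideal.mul_mem_right _ _ (Ideal.mem_map_of_mem _ ?_)
  rw [Submodule.mem_colon_singleton, smul_eq_mul]
  have hl := ha l
  rw [Fintype.sum_option] at hl
  simp only [Option.elim_none, Option.elim_some, neg_mul, Finset.sum_neg_distrib] at hl
  have : a none l * x = ∑ i, j i * a (some i) l := by linear_combination hl
  rw [this]
  exact Ideal.sum_mem _ fun i _ => Ideal.mul_mem_right _ _ (hj i)

variable {Z : Ideal S}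

theorem Ideal.mul_mem_map_sup_of_mem_colon {J K : Ideal R} {x : R}
    (h : ∀ t ∈ K, t * x ∈ J) {s : S} (hs : s ∈ K.map (algebraMap R S) ⊔ Z) :
    algebraMap R S x * s ∈ J.map (algebraMap R S) ⊔ Z := by
  have hle : K.map (algebraMap R S) ⊔ Z ≤
      Submodule.colon (J.map (algebraMap R S) ⊔ Z) {algebraMap R S x} := by
    refine sup_le (Ideal.map_le_iff_le_comap.mpr fun t ht => ?_) fun t ht => ?_
    · rw [Ideal.mem_comap, Submodule.mem_colon_singleton, smul_eq_mul, ← map_mul]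
      exact Ideal.mem_sup_left (Ideal.mem_map_of_mem _ (h t ht))
    · rw [Submodule.mem_colon_singleton, smul_eq_mul]
      exact Ideal.mem_sup_right (Ideal.mul_mem_right _ _ ht)
  have := hle hs
  rwa [Submodule.mem_colon_singleton, smul_eq_mul, mul_comm] at this

theorem Ideal.exists_eq_mul_add_of_mem_map_sup_span {J : Ideal R} {x : R} {s : S}
    (hs : s ∈ (J ⊔ Ideal.span {x}).map (algebraMap R S) ⊔ Z) :
    ∃ w, s - algebraMap R S x * w ∈ J.map (algebraMap R S) ⊔ Z := by
  rw [Ideal.map_sup, sup_right_comm, Ideal.map_span, Set.image_singleton] at hs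
  obtain ⟨j, hj, y, hy, rfl⟩ := Submodule.mem_sup.mp hs
  obtain ⟨w, rfl⟩ := Ideal.mem_span_singleton'.mp hy
  exact ⟨w, by simpa [mul_comm] using hj⟩

variable [IsLocalRing R]

theorem Ideal.extensionCommutesWithColon_bot [Module.Flat R S] :
    (⊥ : Ideal S).ExtensionCommutesWithColon R := by
  intro J _ x s h
  rw [sup_bot_eq] at h ⊢
  exact Ideal.mem_map_colon_of_flat h

theorem Ideal.colon_singleton_le_maximalIdeal {J : Ideal R} {x : R} (hx : x ∉ J) :
    Submodule.colon J {x} ≤ maximalIdeal R := by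
  refine IsLocalRing.le_maximalIdeal fun h => hx ?_
  have : (1 : R) ∈ Submodule.colon J {x} := h ▸ Submodule.mem_top
  simpa [Submodule.mem_colon_singleton] using this

theorem Ideal.ExtensionCommutesWithColon.mem_of_notMem
    (hZ : Z.ExtensionCommutesWithColon R) {J : Ideal R} (hJ : maximalIdeal R ≤ J.radical)
    {x : R} (hx : x ∉ J) {s : S} (hs : algebraMap R S x * s ∈ J.map (algebraMap R S) ⊔ Z) :
    s ∈ (maximalIdeal R).map (algebraMap R S) ⊔ Z :=
  sup_le_sup_right (Ideal.map_mono (Ideal.colon_singleton_le_maximalIdeal hx)) Z (hZ J hJ x s hs)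

theorem Ideal.exists_pow_le_of_maximalIdeal_le_radical [IsNoetherianRing R] {J : Ideal R}
    (hJ : maximalIdeal R ≤ J.radical) : ∃ k, maximalIdeal R ^ k ≤ J :=
  Ideal.exists_pow_le_of_le_radical_of_fg hJ (IsNoetherian.noetherian _)

theorem Ideal.ExtensionCommutesWithColon.isNonzerodivisorModulo [IsNoetherianRing R]
    (hZ : Z.ExtensionCommutesWithColon R) {z : S}
    (hz : ((maximalIdeal R).map (algebraMap R S) ⊔ Z).IsNonzerodivisorModulo z)
    (J : Ideal R) (hJ : maximalIdeal R ≤ J.radical) :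
    (J.map (algebraMap R S) ⊔ Z).IsNonzerodivisorModulo z := by
  induction J using WellFoundedGT.induction with
  | ind J ih =>
    intro w hw
    by_cases htop : (1 : R) ∈ J
    · rw [(Ideal.eq_top_iff_one J).mpr htop, Ideal.map_top, top_sup_eq]
      trivial
    obtain ⟨k, hk⟩ := Ideal.exists_pow_le_of_maximalIdeal_le_radical hJ
    obtain ⟨x, hxJ, hxm⟩ := Submodule.exists_smul_notMem_of_pow_smul_mem k
      (fun t ht => by simpa using hk ht) htop
    simp only [smul_eq_mul, mul_one] at hxJ hxm
    have hlt : J < J ⊔ Ideal.span {x} := lt_of_le_of_ne le_sup_left fun h => hxJ <| by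
      rw [h]; exact Ideal.mem_sup_right (Ideal.mem_span_singleton_self x)
    have hle : J.map (algebraMap R S) ⊔ Z ≤ (J ⊔ Ideal.span {x}).map (algebraMap R S) ⊔ Z :=
      sup_le_sup_right (Ideal.map_mono le_sup_left) Z
    obtain ⟨w', hw'⟩ := Ideal.exists_eq_mul_add_of_mem_map_sup_span
      (ih _ hlt (hJ.trans (Ideal.radical_mono le_sup_left)) w (hle hw))
    have h1 : algebraMap R S x * (z * w') ∈ J.map (algebraMap R S) ⊔ Z := by
      convert! Ideal.sub_mem _ hw (Ideal.mul_mem_left _ z hw') using 1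
      ring
    have h2 := Ideal.mul_mem_map_sup_of_mem_colon hxm (hz w' (hZ.mem_of_notMem hJ hxJ h1))
    simpa using Ideal.add_mem _ hw' h2

theorem Ideal.ExtensionCommutesWithColon.sup_span [IsNoetherianRing R]
    (hZ : Z.ExtensionCommutesWithColon R) {z : S}
    (hz : ((maximalIdeal R).map (algebraMap R S) ⊔ Z).IsNonzerodivisorModulo z) :
    (Z ⊔ Ideal.span {z}).ExtensionCommutesWithColon R := by
  intro J hJ x s hs
  rw [← sup_assoc] at hs
  obtain ⟨j, hj, y, hy, e⟩ := Submodule.mem_sup.mp hs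
  obtain ⟨w, rfl⟩ := Ideal.mem_span_singleton'.mp hy
  have hw : z * w ∈ (J ⊔ Ideal.span {x}).map (algebraMap R S) ⊔ Z := by
    have : z * w = algebraMap R S x * s - j := by linear_combination e
    rw [this]
    refine Ideal.sub_mem _ (Ideal.mem_sup_left (Ideal.mul_mem_right _ _
      (Ideal.mem_map_of_mem _ (Ideal.mem_sup_right (Ideal.mem_span_singleton_self x)))))
      (sup_le_sup_right (Ideal.map_mono le_sup_left) Z hj)
  obtain ⟨w', hw'⟩ := Ideal.exists_eq_mul_add_of_mem_map_sup_span
    (hZ.isNonzerodivisorModulo hz _ (hJ.trans (Ideal.radical_mono le_sup_left)) w hw)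
  have h1 : algebraMap R S x * (s - z * w') ∈ J.map (algebraMap R S) ⊔ Z := by
    have : algebraMap R S x * (s - z * w') = j + z * (w - algebraMap R S x * w') := by
      linear_combination -e
    rw [this]
    exact Ideal.add_mem _ hj (Ideal.mul_mem_left _ _ hw')
  have h2 := hZ J hJ x _ h1
  rw [← sup_assoc, ← sub_add_cancel s (z * w')]
  exact Submodule.add_mem_sup h2 (Ideal.mem_span_singleton'.mpr ⟨w', mul_comm _ _⟩)

theorem Ideal.ExtensionCommutesWithColon.sup_ofList [IsNoetherianRing R]
    (hZ : Z.ExtensionCommutesWithColon R) {l : List S}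
    (hl : ((maximalIdeal R).map (algebraMap R S) ⊔ Z).IsRegularSequenceModulo l) :
    (Z ⊔ Ideal.ofList l).ExtensionCommutesWithColon R := by
  induction l generalizing Z with
  | nil => simpa using hZ
  | cons z l ih =>
    rw [Ideal.ofList_cons, ← sup_assoc]
    exact ih (hZ.sup_span hl.1) (by rw [← sup_assoc]; exact hl.2)

theorem Ideal.ExtensionCommutesWithColon.mem_map_inf
    (hZ : Z.ExtensionCommutesWithColon R) {J : Ideal R} (hJ : maximalIdeal R ≤ J.radical)
    (T : Finset R) {b : S} (h₁ : b ∈ (Ideal.span (T : Set R)).map (algebraMap R S) ⊔ Z)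
    (h₂ : b ∈ J.map (algebraMap R S) ⊔ Z) :
    b ∈ (Ideal.span (T : Set R) ⊓ J).map (algebraMap R S) ⊔ Z := by
  classical
  induction T using Finset.induction_on generalizing b with
  | empty => exact sup_le_sup_right (Ideal.map_mono (by simp)) Z h₁
  | insert x T _ ih =>
    rw [Finset.coe_insert, Ideal.span_insert] at h₁ ⊢
    rw [sup_comm (Ideal.span {x})] at h₁ ⊢
    obtain ⟨s, hs⟩ := Ideal.exists_eq_mul_add_of_mem_map_sup_span h₁
    set K := Ideal.span (T : Set R) with hK
    set W := (K ⊔ Ideal.span {x}) ⊓ J with hW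
    have h3 : algebraMap R S x * s ∈ (J ⊔ K).map (algebraMap R S) ⊔ Z := by
      rw [← sub_sub_cancel b (algebraMap R S x * s)]
      exact Ideal.sub_mem _ (sup_le_sup_right (Ideal.map_mono le_sup_left) Z h₂)
        (sup_le_sup_right (Ideal.map_mono le_sup_right) Z hs)
    have h4 : algebraMap R S x * s ∈ (W ⊔ K).map (algebraMap R S) ⊔ Z := by
      refine Ideal.mul_mem_map_sup_of_mem_colon ?_
        (hZ _ (hJ.trans (Ideal.radical_mono le_sup_left)) x s h3)
      intro r hr
      rw [Submodule.mem_colon_singleton, smul_eq_mul] at hr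
      obtain ⟨j, hj, t, ht, e⟩ := Submodule.mem_sup.mp hr
      rw [← e]
      refine Submodule.add_mem_sup ⟨?_, hj⟩ ht
      rw [eq_sub_of_add_eq e]
      exact Ideal.sub_mem _ (Ideal.mem_sup_right (Ideal.mem_span_singleton'.mpr ⟨r, rfl⟩))
        (Ideal.mem_sup_left ht)
    have h5 : b ∈ W.map (algebraMap R S) ⊔ (K.map (algebraMap R S) ⊔ Z) := by
      rw [← sub_add_cancel b (algebraMap R S x * s)]
      rw [Ideal.map_sup, sup_assoc] at h4
      exact Ideal.add_mem _ (Ideal.mem_sup_right hs) h4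
    obtain ⟨w, hw, t, ht, rfl⟩ := Submodule.mem_sup.mp h5
    have htJ : t ∈ J.map (algebraMap R S) ⊔ Z := by
      rw [← add_sub_cancel_left w t]
      exact Ideal.sub_mem _ h₂ (Ideal.mem_sup_left (Ideal.map_mono inf_le_right hw))
    exact Ideal.add_mem _ (Ideal.mem_sup_left hw)
      (sup_le_sup_right (Ideal.map_mono (inf_le_inf_right J le_sup_left)) Z (ih ht htJ))

theorem Ideal.ExtensionCommutesWithColon.mem_map_colon [IsNoetherianRing R]
    (hZ : Z.ExtensionCommutesWithColon R) {J : Ideal R} (hJ : maximalIdeal R ≤ J.radical)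
    (K : Ideal R) {b : S}
    (h : ∀ x ∈ K, algebraMap R S x * b ∈ J.map (algebraMap R S) ⊔ Z) :
    b ∈ (Submodule.colon J (K : Set R)).map (algebraMap R S) ⊔ Z := by
  classical
  obtain ⟨T, rfl⟩ := IsNoetherian.noetherian K
  have hcol : ∀ T : Finset R, (∀ x ∈ T, algebraMap R S x * b ∈ J.map (algebraMap R S) ⊔ Z) →
      b ∈ (Submodule.colon J (T : Set R)).map (algebraMap R S) ⊔ Z := by
    intro T hT
    induction T using Finset.induction_on with
    | empty => simp [Ideal.map_top]
    | insert x T _ ih =>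
      obtain ⟨U, hU⟩ := IsNoetherian.noetherian (Submodule.colon J {x})
      have h1 := hZ J hJ x b (hT x (by simp))
      have h2 := ih fun y hy => hT y (by simp [hy])
      rw [← hU] at h1
      have h3 := hZ.mem_map_inf (hJ.trans (Ideal.radical_mono ?_)) U h1 h2
      · refine sup_le_sup_right (Ideal.map_mono ?_) Z h3
        intro r hr
        have hrU : r ∈ Submodule.colon J {x} := hU ▸ hr.1
        have hrT : r ∈ Submodule.colon J (T : Set R) := hr.2
        rw [Submodule.mem_colon] at hrU hrT ⊢
        intro y hy
        rcases Finset.mem_insert.mp hy with rfl | hy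
        · exact hrU y rfl
        · exact hrT y hy
      · intro r hr
        rw [Submodule.mem_colon]
        exact fun y _ => Ideal.mul_mem_right _ _ hr
  refine sup_le_sup_right (Ideal.map_mono ?_) Z
    (hcol T fun x hx => h x (Submodule.subset_span hx))
  intro r hr
  rw [Submodule.mem_colon] at hr ⊢
  intro y hy
  induction hy using Submodule.span_induction with
  | mem y hy => exact hr y hy
  | zero => simp
  | add y z _ _ h1 h2 => rw [smul_add]; exact J.add_mem h1 h2
  | smul a y _ h1 => rw [smul_comm]; exact J.mul_mem_left a h1

end FlatColon

section TightClosure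

theorem Ideal.pow_mem_frobPow {R : Type*} [CommRing R] {I : Ideal R} {x : R} (hx : x ∈ I) (q : ℕ) :
    x ^ q ∈ I.frobPow q :=
  Ideal.subset_span ⟨x, hx, rfl⟩

theorem Ideal.le_radical_frobPow {R : Type*} [CommRing R] (I : Ideal R) (q : ℕ) :
    I ≤ (I.frobPow q).radical :=
  fun _ hx => ⟨q, Ideal.pow_mem_frobPow hx q⟩

section CharP

variable {R S : Type*} [CommRing R] [CommRing S] (p : ℕ) [Fact p.Prime] [CharP R p] [CharP S p]

theorem Ideal.frobPow_eq_map (I : Ideal R) (e : ℕ) :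
    I.frobPow (p ^ e) = I.map (iterateFrobenius R p e) :=
  rfl

theorem Ideal.frobPow_map (f : R →+* S) (I : Ideal R) (e : ℕ) :
    (I.map f).frobPow (p ^ e) = (I.frobPow (p ^ e)).map f := by
  rw [Ideal.frobPow_eq_map, Ideal.frobPow_eq_map, Ideal.map_map, Ideal.map_map]
  congr 1
  ext x
  simp [iterateFrobenius_def]

theorem Ideal.frobPow_sup (I J : Ideal R) (e : ℕ) :
    (I ⊔ J).frobPow (p ^ e) = I.frobPow (p ^ e) ⊔ J.frobPow (p ^ e) := by
  simp only [Ideal.frobPow_eq_map, Ideal.map_sup]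

theorem Ideal.frobPow_span_range {ι : Type*} (z : ι → R) (e : ℕ) :
    (Ideal.span (Set.range z)).frobPow (p ^ e) = Ideal.span (Set.range fun i => z i ^ p ^ e) := by
  rw [Ideal.frobPow_eq_map, Ideal.map_span, ← Set.range_comp]
  rfl

theorem Ideal.frobPow_frobPow (I : Ideal R) (a b : ℕ) :
    (I.frobPow (p ^ a)).frobPow (p ^ b) = I.frobPow (p ^ (a + b)) := by
  rw [Ideal.frobPow_eq_map, Ideal.frobPow_eq_map, Ideal.frobPow_eq_map, Ideal.map_map]
  congr 1
  ext x
  simp [iterateFrobenius_def, pow_add, pow_mul]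

theorem Ideal.IsTightlyClosed.mem_of_pow_mem_frobPow {I : Ideal R} (hI : I.IsTightlyClosed p)
    {u : R} {e : ℕ} (hu : u ^ p ^ e ∈ I.frobPow (p ^ e)) : u ∈ I := by
  refine hI u ⟨1, fun P hP h => hP.isPrime.ne_top ((Ideal.eq_top_iff_one P).mpr h), e,
    fun f hf => ?_⟩
  obtain ⟨k, rfl⟩ := Nat.exists_eq_add_of_le hf
  rw [one_mul, ← Ideal.frobPow_frobPow, pow_add, pow_mul]
  exact Ideal.pow_mem_frobPow hu _

end CharP

theorem algebraMap_mem_circComplement {R S : Type*} [CommRing R] [CommRing S] [Algebra R S]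
    [Module.Flat R S] {c : R} (hc : c ∈ circComplement R) :
    algebraMap R S c ∈ circComplement S := by
  intro P hP hcP
  have hPp : P.IsPrime := hP.isPrime
  obtain ⟨Q, hQ, hQle⟩ := Ideal.exists_minimalPrimes_le (I := ⊥) (J := P.under R) bot_le
  have hQp : Q.IsPrime := hQ.1.1
  obtain ⟨P', hP'le, hP'p, hP'⟩ := Ideal.exists_ideal_le_liesOver_of_le P hQle
  have hPP' : P' = P := le_antisymm hP'le (hP.2 ⟨hP'p, bot_le⟩ hP'le)
  refine hc Q hQ ?_
  rw [hP'.over, hPP']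
  exact hcP

theorem exists_add_mem_of_mem_minimalPrimes {A : Type*} [CommRing A]
    [IsNoetherianRing A] [IsReduced A] {P : Ideal A} (hP : P ∈ minimalPrimes A) :
    ∃ a b : A, a ∈ P ∧ (∀ t ∈ P, t * b = 0) ∧ a + b ∈ circComplement A := by
  have hfin : (minimalPrimes A).Finite := minimalPrimes.finite_of_isNoetherianRing A
  set s := hfin.toFinset.erase P with hs
  set K : Ideal A := s.inf id with hK
  have hKP : ¬ K ≤ P := by
    rw [hK, hP.isPrime.inf_le']
    rintro ⟨Q, hQ, hQP⟩
    have hQ' : Q ≠ P ∧ Q ∈ minimalPrimes A := by simpa [hs] using hQ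
    exact hQ'.1 (le_antisymm hQP (hP.2 hQ'.2.1 hQP))
  obtain ⟨w, hw, hw'⟩ := Ideal.exists_mem_forall_notMem_of_finite hfin id
    (fun Q hQ => hQ.isPrime) (P ⊔ K) (fun Q hQ hle => by
      have hPQ : P = Q := le_antisymm (le_sup_left.trans hle)
        (hQ.2 hP.1 (le_sup_left.trans hle))
      exact hKP (hPQ ▸ le_sup_right.trans hle))
  obtain ⟨a, ha, b, hb, rfl⟩ := Submodule.mem_sup.mp hw
  refine ⟨a, b, ha, fun t ht => ?_, hw'⟩
  have hmem : t * b ∈ sInf (minimalPrimes A) := by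
    refine Submodule.mem_sInf.mpr fun Q hQ => ?_
    by_cases hQP : Q = P
    · exact hQP ▸ P.mul_mem_right _ ht
    · have hKQ : K ≤ Q := Finset.inf_le (f := id) (by simp [hs, hQP, hQ])
      exact Ideal.mul_mem_left Q _ (hKQ hb)
  rw [minimalPrimes, Ideal.sInf_minimalPrimes] at hmem
  simpa [Ideal.mem_radical_iff] using hmem

theorem mem_nonZeroDivisors_of_mem_circComplement {A : Type*} [CommRing A] [IsReduced A] {w : A}
    (hw : w ∈ circComplement A) : w ∈ nonZeroDivisors A := by
  refine mem_nonZeroDivisors_iff_right.mpr fun t ht => ?_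
  have hmem : t ∈ sInf (minimalPrimes A) := by
    refine Submodule.mem_sInf.mpr fun Q hQ => ?_
    exact (hQ.isPrime.mem_or_mem (ht ▸ Q.zero_mem)).resolve_right (hw Q hQ)
  rw [minimalPrimes, Ideal.sInf_minimalPrimes] at hmem
  simpa [Ideal.mem_radical_iff] using hmem

variable {A : Type*} [CommRing A] [IsLocalRing A]

theorem IsLocalRing.maximalIdeal_le_radical_of_mem_minimalPrimes {I : Ideal A}
    (h : maximalIdeal A ∈ I.minimalPrimes) : maximalIdeal A ≤ I.radical := by
  rw [Ideal.radical_eq_sInf]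
  exact le_sInf fun Q hQ => h.2 ⟨hQ.2, hQ.1⟩ (IsLocalRing.le_maximalIdeal hQ.2.ne_top)

theorem exists_isSystemOfParameters_cons [IsNoetherianRing A] {x : A}
    (hx : x ∈ maximalIdeal A) (hreg : x ∈ nonZeroDivisors A) :
    ∃ (n : ℕ) (y : Fin n → A), IsSystemOfParameters A (Fin.cons x y : Fin (n + 1) → A) := by
  have hne : Ideal.span {x} ≠ ⊤ := fun h => by
    rw [Ideal.span_singleton_eq_top] at h
    exact hx h
  have := Ideal.Quotient.nontrivial_iff.mpr hne
  have hsurj : Function.Surjective (Ideal.Quotient.mk (Ideal.span {x})) :=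
    Ideal.Quotient.mk_surjective
  have : IsLocalRing (A ⧸ Ideal.span {x}) := IsLocalRing.of_surjective' _ hsurj
  have : IsLocalHom (Ideal.Quotient.mk (Ideal.span {x})) := IsLocalHom.of_surjective _ hsurj
  obtain ⟨s, hs, hcard⟩ := Ideal.exists_finset_card_eq_height_of_isNoetherianRing
    (maximalIdeal (A ⧸ Ideal.span {x}))
  choose f hf using hsurj
  refine ⟨s.card, fun i => f (s.equivFin.symm i), ?_, ?_, ?_⟩
  · have h := IsLocalRing.maximalIdeal_height_eq_ringKrullDim (R := A ⧸ Ideal.span {x})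
    rw [← ringKrullDim_quotient_span_singleton_succ_eq_ringKrullDim_of_mem_nonZeroDivisors hreg hx,
      ← h, ← hcard]
    norm_cast
  · intro i
    refine Fin.cases hx (fun i hu => ?_) i
    have hmem : ((s.equivFin.symm i : A ⧸ Ideal.span {x})) ∈ maximalIdeal (A ⧸ Ideal.span {x}) :=
      hs.1.2 (Ideal.subset_span (s.equivFin.symm i).2)
    refine hmem ?_
    rw [← hf (s.equivFin.symm i)]
    exact IsUnit.map _ hu
  · intro t ht
    have htm : Ideal.Quotient.mk (Ideal.span {x}) t ∈ maximalIdeal (A ⧸ Ideal.span {x}) :=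
      fun hu => ht (isUnit_of_map_unit _ t hu)
    obtain ⟨k, hk⟩ := IsLocalRing.maximalIdeal_le_radical_of_mem_minimalPrimes hs htm
    refine ⟨k, ?_⟩
    have hle : Ideal.span (s : Set (A ⧸ Ideal.span {x})) ≤
        (Ideal.span (Set.range (Fin.cons x fun i => f (s.equivFin.symm i) :
          Fin (s.card + 1) → A))).map (Ideal.Quotient.mk (Ideal.span {x})) := by
      refine Ideal.span_le.mpr fun y hy => ?_
      have := Ideal.mem_map_of_mem (Ideal.Quotient.mk (Ideal.span {x}))
        (Ideal.subset_span (Set.mem_range_self (f := (Fin.cons x fun i => f (s.equivFin.symm i) :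
          Fin (s.card + 1) → A)) (s.equivFin ⟨y, hy⟩).succ))
      simpa [hf] using this
    rw [← map_pow] at hk
    have hk' := hle hk
    rw [← Ideal.mem_comap, Ideal.comap_map_of_surjective _ Ideal.Quotient.mk_surjective,
      ← RingHom.ker_eq_comap_bot, Ideal.mk_ker, sup_of_le_left] at hk'
    · exact hk'
    · rw [Ideal.span_singleton_le_iff_mem]
      exact Ideal.subset_span ⟨0, rfl⟩

theorem IsFRational.isReduced {p : ℕ} (hp : p.Prime) (h : IsFRational A p) {n : ℕ} {x : Fin n → A}
    (hx : IsSystemOfParameters A x) : IsReduced A := by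
  refine ⟨fun a ⟨k, hk⟩ => ?_⟩
  have hbot := h ⊥ ⟨n, 0, Nat.zero_le n, x, hx, by simp⟩ a
    ⟨1, fun P hP h => hP.isPrime.ne_top ((Ideal.eq_top_iff_one P).mpr h), k, fun e he => ?_⟩
  · simpa using hbot
  · rw [pow_eq_zero_of_le (he.trans (Nat.lt_pow_self hp.one_lt).le) hk, mul_zero]
    exact Ideal.zero_mem _

theorem IsFRational.isTightlyClosed_span_singleton [IsNoetherianRing A] {p : ℕ}
    (h : IsFRational A p) {x : A} (hreg : x ∈ nonZeroDivisors A) :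
    (Ideal.span {x}).IsTightlyClosed p := by
  by_cases hx : x ∈ maximalIdeal A
  · obtain ⟨n, y, hy⟩ := exists_isSystemOfParameters_cons hx hreg
    refine h _ ⟨n + 1, 1, by lia, _, hy, ?_⟩
    congr 1
    ext t
    simp [Set.mem_range, eq_comm]
  · have : Ideal.span {x} = ⊤ := Ideal.span_singleton_eq_top.mpr (by simpa using hx)
    rw [this]
    exact fun _ _ => trivial

theorem IsFRational.isDomain [IsNoetherianRing A] {p : ℕ} (hp : p.Prime) (h : IsFRational A p)
    {n : ℕ} {x : Fin n → A} (hx : IsSystemOfParameters A x) : IsDomain A := by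
  have := h.isReduced hp hx
  obtain ⟨P, hP, -⟩ := Ideal.exists_minimalPrimes_le (I := (⊥ : Ideal A)) (J := maximalIdeal A)
    bot_le
  suffices hbot : P = ⊥ by
    have hprime : (⊥ : Ideal A).IsPrime := hbot ▸ hP.1.1
    exact IsDomain.of_bot_isPrime A
  obtain ⟨a, b, ha, hPb, hw⟩ := exists_add_mem_of_mem_minimalPrimes hP
  have hreg := mem_nonZeroDivisors_of_mem_circComplement hw
  have hab : a * b = 0 := hPb a ha
  have hpow : ∀ k : ℕ, a * (a + b) ^ k = a ^ (k + 1) := by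
    intro k
    induction k with
    | zero => simp
    | succ k ih => rw [pow_succ, ← mul_assoc, ih]; linear_combination a ^ k * hab
  have hmem : a ∈ Ideal.span {a + b} := by
    refine h.isTightlyClosed_span_singleton hreg a ⟨a + b, hw, 0, fun e _ => ?_⟩
    have : (a + b) * a ^ p ^ e = a * (a + b) ^ p ^ e := by
      rw [hpow]
      obtain ⟨k, hk⟩ := Nat.exists_eq_succ_of_ne_zero (pow_ne_zero e hp.ne_zero)
      rw [hk, Nat.succ_eq_add_one]
      linear_combination a ^ k * hab
    rw [this]
    exact Ideal.mul_mem_left _ _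
      (Ideal.pow_mem_frobPow (Ideal.mem_span_singleton_self _) _)
  obtain ⟨r, hr⟩ := Ideal.mem_span_singleton'.mp hmem
  have hrb : r * b = 0 := by
    have hsq : (r * b) ^ 2 = 0 := by linear_combination r * b * hr + (r * (1 - r)) * hab
    exact pow_eq_zero_iff two_ne_zero |>.mp hsq
  rcases IsLocalRing.isUnit_or_isUnit_one_sub_self r with hu | hu
  · have hb : b = 0 := hu.mul_right_eq_zero.mp hrb
    exact absurd (by simpa [hb] using ha) (hw P hP)
  · have ha0 : a = 0 := hu.mul_right_eq_zero.mp (by linear_combination -hr + hrb)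
    rw [eq_bot_iff]
    intro t ht
    refine (mem_nonZeroDivisors_iff_right.mp hreg) t ?_
    rw [ha0, zero_add, hPb t ht]

end TightClosure

section Extension

theorem IsSystemOfParameters.pow {A : Type*} [CommRing A] [IsLocalRing A] {d : ℕ} {x : Fin d → A}
    (hx : IsSystemOfParameters A x) {t : ℕ} (ht : 0 < t) :
    IsSystemOfParameters A (fun i => x i ^ t) := by
  refine ⟨hx.1, fun i => Ideal.pow_mem_of_mem _ (hx.2.1 i) t ht, ?_⟩
  refine hx.2.2.trans ?_
  rw [Ideal.radical_le_radical_iff]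
  refine Ideal.span_le.mpr ?_
  rintro _ ⟨i, rfl⟩
  exact ⟨t, Ideal.subset_span ⟨i, rfl⟩⟩

theorem IsFRational.isTightlyClosed_span_range {A : Type*} [CommRing A] [IsLocalRing A] {p : ℕ}
    (h : IsFRational A p) {d : ℕ} {x : Fin d → A} (hx : IsSystemOfParameters A x) :
    (Ideal.span (Set.range x)).IsTightlyClosed p :=
  h _ ⟨d, d, le_rfl, x, hx, rfl⟩

theorem Ideal.ofList_ofFn {A : Type*} [CommRing A] {d : ℕ} (x : Fin d → A) :
    Ideal.ofList (List.ofFn x) = Ideal.span (Set.range x) := by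
  rw [Ideal.ofList]
  congr 1
  ext
  simp

theorem IsLocalRing.maximalIdeal_le_radical_of_isFiniteLength {R : Type*} [CommRing R]
    [IsLocalRing R] {I : Ideal R} (h : IsFiniteLength R (R ⧸ I)) :
    maximalIdeal R ≤ I.radical := by
  have hart : IsArtinian R (R ⧸ I) := (isFiniteLength_iff_isNoetherian_isArtinian.mp h).2
  have : IsArtinianRing (R ⧸ I) := isArtinian_of_tower R hart
  rw [Ideal.radical_eq_sInf]
  refine le_sInf fun P hP => ?_
  obtain ⟨hIP, hP⟩ := hP
  have hmap : (P.map (Ideal.Quotient.mk I)).IsPrime :=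
    Ideal.map_isPrime_of_surjective Ideal.Quotient.mk_surjective (by rwa [Ideal.mk_ker])
  have hmax := IsArtinianRing.isMaximal_of_isPrime (P.map (Ideal.Quotient.mk I))
  have hPmax := Ideal.comap_isMaximal_of_surjective (Ideal.Quotient.mk I)
    Ideal.Quotient.mk_surjective (K := P.map (Ideal.Quotient.mk I))
  rw [Ideal.comap_map_quotientMk, sup_eq_right.mpr hIP] at hPmax
  exact (IsLocalRing.eq_maximalIdeal hPmax).ge

variable {R S : Type*} [CommRing R] [CommRing S] [Algebra R S]

theorem IsCohenMacaulayLocalRing.extensionCommutesWithColon_span_range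
    [IsNoetherianRing R] [IsNoetherianRing S] [IsLocalRing R] [Module.Flat R S]
    [IsLocalRing (S ⧸ (maximalIdeal R).map (algebraMap R S))]
    (hCM : IsCohenMacaulayLocalRing (S ⧸ (maximalIdeal R).map (algebraMap R S)))
    {d : ℕ} {z : Fin d → S}
    (hz : IsSystemOfParameters (S ⧸ (maximalIdeal R).map (algebraMap R S))
      (fun i => Ideal.Quotient.mk ((maximalIdeal R).map (algebraMap R S)) (z i))) :
    (Ideal.span (Set.range z)).ExtensionCommutesWithColon R := by
  obtain ⟨n, x, hx, hreg⟩ := hCM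
  obtain rfl : n = d := by
    have := hx.1.symm.trans hz.1
    exact_mod_cast this
  have hmod : (⊥ : Ideal (S ⧸ (maximalIdeal R).map (algebraMap R S))).IsRegularSequenceModulo
      ((List.ofFn z).map (Ideal.Quotient.mk ((maximalIdeal R).map (algebraMap R S)))) := by
    rw [List.map_ofFn]
    refine Ideal.IsRegularSequenceModulo.of_le_radical n ⊥ (List.ofFn x) _ (by simp) (by simp)
      ?_ ?_ hreg.toIsWeaklyRegular.isRegularSequenceModulo_bot ?_
    · simpa [List.forall_mem_ofFn_iff] using hx.2.1
    · simpa [List.forall_mem_ofFn_iff] using hz.2.1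
    · rw [bot_sup_eq, Ideal.ofList_ofFn]
      exact hz.2.2
  have hmod' := Ideal.IsRegularSequenceModulo.comap Ideal.Quotient.mk_surjective hmod
  rw [← RingHom.ker_eq_comap_bot, Ideal.mk_ker] at hmod'
  rw [← Ideal.ofList_ofFn, ← bot_sup_eq (Ideal.ofList _)]
  exact Ideal.extensionCommutesWithColon_bot.sup_ofList (by rwa [sup_bot_eq])

variable {p : ℕ} [Fact p.Prime] [CharP R p] [CharP S p]

theorem Ideal.IsTightlyClosed.of_map_sup [Module.Flat R S] {I : Ideal R} {Z : Ideal S}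
    (h : (I.map (algebraMap R S) ⊔ Z).IsTightlyClosed p)
    (hcontr : ∀ x : R, algebraMap R S x ∈ I.map (algebraMap R S) ⊔ Z → x ∈ I) :
    I.IsTightlyClosed p := by
  rintro x ⟨c, hc, N, hN⟩
  refine hcontr x (h _ ⟨algebraMap R S c, algebraMap_mem_circComplement hc, N, fun e he => ?_⟩)
  rw [← map_pow, ← map_mul, Ideal.frobPow_sup, Ideal.frobPow_map]
  exact Ideal.mem_sup_left (Ideal.mem_map_of_mem _ (hN e he))

theorem Ideal.IsTightlyClosed.map_sup [IsNoetherianRing R] [IsLocalRing R]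
    [IsDomain (S ⧸ (maximalIdeal R).map (algebraMap R S))]
    {I : Ideal R} (hI : I.IsTightlyClosed p) (hrad : maximalIdeal R ≤ I.radical)
    (hsoc : SocleDimOne I) {Z : Ideal S}
    (hZ : ∀ e : ℕ, (Z.frobPow (p ^ e)).ExtensionCommutesWithColon R)
    (hZcl : (Z.map (Ideal.Quotient.mk ((maximalIdeal R).map (algebraMap R S)))).IsTightlyClosed p)
    {c : S} (hc : c ∉ (maximalIdeal R).map (algebraMap R S)) (hcS : IsTestElement p c) :
    (I.map (algebraMap R S) ⊔ Z).IsTightlyClosed p := by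
  set M := (maximalIdeal R).map (algebraMap R S)
  set φ := algebraMap R S
  obtain ⟨u, humem, hu, hgen⟩ := hsoc
  have hmu : ∀ t ∈ maximalIdeal R, t * u ∈ I := fun t ht => by
    simpa [mul_comm] using Submodule.mem_colon.mp humem t ht
  have hcolon : Submodule.colon I (maximalIdeal R : Set R) ≤ I ⊔ Ideal.span {u} := by
    intro v hv
    obtain ⟨r, hr⟩ := hgen v hv
    rw [← sub_add_cancel v (r * u)]
    exact Submodule.add_mem_sup hr (Ideal.mem_span_singleton'.mpr ⟨r, rfl⟩)
  have hZ₁ : Z.ExtensionCommutesWithColon R := by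
    have h := hZ 0
    rwa [Ideal.frobPow_eq_map, iterateFrobenius_zero, Ideal.map_id] at h
  intro a ha
  by_contra haQ
  obtain ⟨k, hk⟩ := Ideal.exists_pow_le_of_maximalIdeal_le_radical hrad
  obtain ⟨r, hrQ, hrm⟩ := Submodule.exists_smul_notMem_of_pow_smul_mem (m := maximalIdeal R)
    (N := (I.map φ ⊔ Z).restrictScalars R) (a := a) k (fun t ht => by
      rw [Submodule.restrictScalars_mem, Algebra.smul_def]
      exact Ideal.mul_mem_right _ _ (Ideal.mem_sup_left (Ideal.mem_map_of_mem _ (hk ht)))) haQ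
  have hb := hZ₁.mem_map_colon hrad (maximalIdeal R) (b := r • a) fun x hx => by
    rw [← Algebra.smul_def]
    exact hrm x hx
  obtain ⟨s, hs⟩ := Ideal.exists_eq_mul_add_of_mem_map_sup_span
    (sup_le_sup_right (Ideal.map_mono hcolon) Z hb)
  have hsM : ∀ e : ℕ, c * s ^ p ^ e ∈ M ⊔ Z.frobPow (p ^ e) := fun e => by
    refine (hZ e).mem_of_notMem (J := I.frobPow (p ^ e)) (x := u ^ p ^ e)
      (hrad.trans ?_) (fun h => hu (hI.mem_of_pow_mem_frobPow p h)) ?_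
    · exact Ideal.radical_le_radical_iff.mpr (Ideal.le_radical_frobPow I _)
    · rw [← Ideal.frobPow_map p, ← Ideal.frobPow_sup p]
      have h₁ := Ideal.pow_mem_frobPow hs (p ^ e)
      rw [sub_pow_char_pow] at h₁
      have h₂ := hcS.2 _ a ha e
      have h₃ := Ideal.sub_mem _ (Ideal.mul_mem_left _ (φ r ^ p ^ e) h₂)
        (Ideal.mul_mem_left _ c h₁)
      convert h₃ using 1
      rw [Algebra.smul_def, map_pow]
      ring
  have hsZ : Ideal.Quotient.mk M s ∈ Z.map (Ideal.Quotient.mk M) := by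
    refine hZcl _ ⟨Ideal.Quotient.mk M c, ?_, 0, fun e _ => ?_⟩
    · rw [circComplement, IsDomain.minimalPrimes_eq_singleton_bot]
      simpa [Ideal.Quotient.eq_zero_iff_mem] using hc
    · have h := hsM e
      rw [sup_comm, ← Ideal.mem_quotient_iff_mem_sup, map_mul, map_pow] at h
      refine Ideal.map_le_iff_le_comap.mpr ?_ h
      refine Ideal.span_le.mpr ?_
      rintro _ ⟨y, hy, rfl⟩
      rw [SetLike.mem_coe, Ideal.mem_comap, map_pow]
      exact Ideal.pow_mem_frobPow (Ideal.mem_map_of_mem _ hy) _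
  rw [Ideal.mem_quotient_iff_mem_sup, sup_comm] at hsZ
  refine hrQ ?_
  have h := Ideal.add_mem _ hs (Ideal.mul_mem_map_sup_of_mem_colon hmu hsZ)
  rwa [sub_add_cancel] at h

end Extension

/-- **Proposition 3.2(1)** (Aberbach). Let `φ : (R,m,K) → (S,n,L)` be a flat local
homomorphism of Noetherian local rings of prime characteristic `p` with `S/mS` Gorenstein,
let `z₁,…,z_d ∈ S` induce a system of parameters of `S/mS`, and let `I ⊆ R` with
`ℓ(R/I) < ∞` and one-dimensional socle. If some `c ∈ S − mS` is a test element
for `S` and `S/mS` is F-rational, then: `I` is tightly closed in `R` iff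
`IS + (z)^[t]` is tightly closed in `S` for every `t > 0` iff `IS + (z)^[t]` is
tightly closed in `S` for some `t > 0`. -/
theorem tightlyClosed_extension_iff_of_test_element_outside
    (p : ℕ) [Fact p.Prime]
    (R S : Type*) [CommRing R] [CommRing S]
    [IsNoetherianRing R] [IsNoetherianRing S]
    [IsLocalRing R] [IsLocalRing S] [CharP R p] [CharP S p]
    [Algebra R S] [Module.Flat R S] [IsLocalHom (algebraMap R S)]
    [IsLocalRing (S ⧸ Ideal.map (algebraMap R S) (IsLocalRing.maximalIdeal R))]
    (hGor : IsGorensteinLocalRing (S ⧸ Ideal.map (algebraMap R S) (IsLocalRing.maximalIdeal R)))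
    (d : ℕ) (z : Fin d → S)
    (hz : IsSystemOfParameters (S ⧸ Ideal.map (algebraMap R S) (IsLocalRing.maximalIdeal R))
      (fun i => Ideal.Quotient.mk (Ideal.map (algebraMap R S) (IsLocalRing.maximalIdeal R)) (z i)))
    (I : Ideal R) (hlen : IsFiniteLength R (R ⧸ I)) (hsoc : SocleDimOne I)
    (c : S) (hc : c ∉ Ideal.map (algebraMap R S) (IsLocalRing.maximalIdeal R))
    (hcS : IsTestElement p c)
    (hFrat : IsFRational (S ⧸ Ideal.map (algebraMap R S) (IsLocalRing.maximalIdeal R)) p) :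
    (I.IsTightlyClosed p ↔ ∀ t : ℕ, 0 < t →
      (Ideal.map (algebraMap R S) I ⊔
        Ideal.span (Set.range fun i => z i ^ t)).IsTightlyClosed p) ∧
    (I.IsTightlyClosed p ↔ ∃ t : ℕ, 0 < t ∧
      (Ideal.map (algebraMap R S) I ⊔
        Ideal.span (Set.range fun i => z i ^ t)).IsTightlyClosed p) := by
  set M := (maximalIdeal R).map (algebraMap R S)
  obtain ⟨n, x, hx, hxreg, -⟩ := hGor
  have hdom : IsDomain (S ⧸ M) := hFrat.isDomain Fact.out hz
  have hrad := IsLocalRing.maximalIdeal_le_radical_of_isFiniteLength hlen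
  have hzpow : ∀ t : ℕ, 0 < t →
      IsSystemOfParameters (S ⧸ M) (fun i => Ideal.Quotient.mk M (z i ^ t)) := fun t ht => by
    simpa only [map_pow] using hz.pow ht
  have hcolon : ∀ t : ℕ, 0 < t →
      (Ideal.span (Set.range fun i => z i ^ t)).ExtensionCommutesWithColon R := fun t ht =>
    IsCohenMacaulayLocalRing.extensionCommutesWithColon_span_range ⟨n, x, hx, hxreg⟩ (hzpow t ht)
  have hup : I.IsTightlyClosed p → ∀ t : ℕ, 0 < t → (I.map (algebraMap R S) ⊔
      Ideal.span (Set.range fun i => z i ^ t)).IsTightlyClosed p := by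
    intro hI t ht
    refine hI.map_sup hrad hsoc (fun e => ?_) ?_ hc hcS
    · rw [Ideal.frobPow_span_range]
      simp only [← pow_mul]
      exact hcolon _ (Nat.mul_pos ht (pow_pos (Fact.out : p.Prime).pos e))
    · rw [Ideal.map_span, ← Set.range_comp]
      exact hFrat.isTightlyClosed_span_range (hzpow t ht)
  have hdown : ∀ t : ℕ, 0 < t → (I.map (algebraMap R S) ⊔
      Ideal.span (Set.range fun i => z i ^ t)).IsTightlyClosed p → I.IsTightlyClosed p := by
    intro t ht h
    refine h.of_map_sup fun y hy => ?_
    by_contra hyI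
    have hone := (hcolon t ht).mem_of_notMem hrad hyI (s := 1) (by rwa [mul_one])
    rw [sup_comm, ← Ideal.mem_quotient_iff_mem_sup, map_one, Ideal.map_span, ← Set.range_comp]
      at hone
    have hle : Ideal.span (Set.range (Ideal.Quotient.mk M ∘ fun i => z i ^ t)) ≤
        maximalIdeal (S ⧸ M) := by
      refine Ideal.span_le.mpr ?_
      rintro _ ⟨i, rfl⟩
      exact (hzpow t ht).2.1 i
    exact (Ideal.ne_top_iff_one _).mp (maximalIdeal.isMaximal (S ⧸ M)).ne_top (hle hone)
  exact ⟨⟨hup, fun h => hdown 1 one_pos (h 1 one_pos)⟩,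
    ⟨fun h => ⟨1, one_pos, hup h 1 one_pos⟩, fun ⟨t, ht, h⟩ => hdown t ht h⟩⟩
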